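/- (Key intermediate inequality in the proof of Theorem 4.1.) If the 4×4 complex Hermitian matrix Q is positive semidefinite, then E₀ · ((E₀ + |c'| + |J₍₄₎|)² − A − |c'|² − |J₍₄₎|²) ≥ 0. -/

import Mathlib

noncomputable section

open Matrix
open scoped ComplexOrder

/-- Euclidean dot product on ℝ³. -/
def dot3 (u v : Fin 3 → ℝ) : ℝ := u 0 * v 0 + u 1 * v 1 + u 2 * v 2

/-- Cross product on ℝ³. -/
def cross3 (u v : Fin 3 → ℝ) : Fin 3 → ℝ :=
  ![u 1 * v 2 - u 2 * v 1, u 2 * v 0 - u 0 * v 2, u 0 * v 1 - u 1 * v 0]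

/-- Euclidean norm on ℝ³. -/
def norm3 (u : Fin 3 → ℝ) : ℝ := Real.sqrt (dot3 u u)

/-- The 4×4 Hermitian matrix Q = [[E, L], [L*, Ê]] from the positive energy theorem. -/
def Qmat (E₀ c₁ c₂ c₃ c₄ c₁' c₂' c₃' c₄' J₁₂ J₁₃ J₂₃ J₁₄ J₂₄ J₃₄ : ℝ) :
    Matrix (Fin 4) (Fin 4) ℂ :=
  !![((E₀ + c₄ + c₃' - J₃₄ : ℝ) : ℂ),
     (c₁' : ℂ) + Complex.I * (c₂' : ℂ) - (J₁₄ : ℂ) - Complex.I * (J₂₄ : ℂ),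
     (c₃ : ℂ) - (c₄' : ℂ) + Complex.I * (J₁₂ : ℂ),
     (c₁ : ℂ) + Complex.I * (c₂ : ℂ) + (J₁₃ : ℂ) + Complex.I * (J₂₃ : ℂ);
     (c₁' : ℂ) - Complex.I * (c₂' : ℂ) - (J₁₄ : ℂ) + Complex.I * (J₂₄ : ℂ),
     ((E₀ + c₄ - c₃' + J₃₄ : ℝ) : ℂ),
     (c₁ : ℂ) - Complex.I * (c₂ : ℂ) - (J₁₃ : ℂ) + Complex.I * (J₂₃ : ℂ),
     -(c₃ : ℂ) - (c₄' : ℂ) - Complex.I * (J₁₂ : ℂ);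
     (c₃ : ℂ) - (c₄' : ℂ) - Complex.I * (J₁₂ : ℂ),
     (c₁ : ℂ) + Complex.I * (c₂ : ℂ) - (J₁₃ : ℂ) - Complex.I * (J₂₃ : ℂ),
     ((E₀ - c₄ - c₃' - J₃₄ : ℝ) : ℂ),
     -(c₁' : ℂ) - Complex.I * (c₂' : ℂ) - (J₁₄ : ℂ) - Complex.I * (J₂₄ : ℂ);
     (c₁ : ℂ) - Complex.I * (c₂ : ℂ) + (J₁₃ : ℂ) - Complex.I * (J₂₃ : ℂ),
     -(c₃ : ℂ) - (c₄' : ℂ) + Complex.I * (J₁₂ : ℂ),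
     -(c₁' : ℂ) + Complex.I * (c₂' : ℂ) - (J₁₄ : ℂ) + Complex.I * (J₂₄ : ℂ),
     ((E₀ - c₄ + c₃' + J₃₄ : ℝ) : ℂ)]

lemma norm3_nonneg (u : Fin 3 → ℝ) : 0 ≤ norm3 u := Real.sqrt_nonneg _

lemma norm3_sq (u : Fin 3 → ℝ) : norm3 u ^ 2 = dot3 u u := by
  apply Real.sq_sqrt
  simp only [dot3]
  nlinarith [mul_self_nonneg (u 0), mul_self_nonneg (u 1), mul_self_nonneg (u 2)]

lemma abs_dot3_le (u v : Fin 3 → ℝ) : |dot3 u v| ≤ norm3 u * norm3 v := by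
  apply abs_le_of_sq_le_sq _ (mul_nonneg (norm3_nonneg u) (norm3_nonneg v))
  rw [mul_pow, norm3_sq, norm3_sq]
  simp only [dot3]
  nlinarith [sq_nonneg (u 0 * v 1 - u 1 * v 0), sq_nonneg (u 0 * v 2 - u 2 * v 0),
    sq_nonneg (u 1 * v 2 - u 2 * v 1)]

lemma norm3_cross3_le (u v : Fin 3 → ℝ) : norm3 (cross3 u v) ≤ norm3 u * norm3 v := by
  refine (sq_le_sq₀ (norm3_nonneg _)
    (mul_nonneg (norm3_nonneg u) (norm3_nonneg v))).mp ?_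
  rw [mul_pow, norm3_sq, norm3_sq, norm3_sq]
  simp only [dot3, cross3, Matrix.cons_val]
  nlinarith [sq_nonneg (u 0 * v 0 + u 1 * v 1 + u 2 * v 2)]

/-- A principal minor of a positive semidefinite complex matrix has nonnegative real part. -/
lemma Matrix.PosSemidef.re_det_submatrix_nonneg {m n : Type*} [Fintype m] [DecidableEq m]
    {M : Matrix n n ℂ} (hM : M.PosSemidef) (f : m → n) : 0 ≤ (M.submatrix f f).det.re :=
  (Complex.le_def.mp (hM.submatrix f).det_nonneg).1

section Qmat

variable {E₀ c₁ c₂ c₃ c₄ c₁' c₂' c₃' c₄' J₁₂ J₁₃ J₂₃ J₁₄ J₂₄ J₃₄ : ℝ}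

lemma Qmat_energy_nonneg
    (hQ : (Qmat E₀ c₁ c₂ c₃ c₄ c₁' c₂' c₃' c₄' J₁₂ J₁₃ J₂₃ J₁₄ J₂₄ J₃₄).PosSemidef) :
    0 ≤ E₀ := by
  have h0 := hQ.re_det_submatrix_nonneg ![0]
  have h1 := hQ.re_det_submatrix_nonneg ![1]
  have h2 := hQ.re_det_submatrix_nonneg ![2]
  have h3 := hQ.re_det_submatrix_nonneg ![3]
  rw [det_fin_one] at h0 h1 h2 h3
  simp [Qmat] at h0 h1 h2 h3
  linarith

/-- The sum of the four `2 × 2` principal minors of `Q` mixing the two diagonal blocks is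
nonnegative. -/
lemma Qmat_quadratic_le
    (hQ : (Qmat E₀ c₁ c₂ c₃ c₄ c₁' c₂' c₃' c₄' J₁₂ J₁₃ J₂₃ J₁₄ J₂₄ J₃₄).PosSemidef) :
    2 * c₄ ^ 2 + c₄' ^ 2 + norm3 ![c₁, c₂, c₃] ^ 2 + norm3 ![J₂₃, -J₁₃, J₁₂] ^ 2
      ≤ 2 * E₀ ^ 2 := by
  have h02 := hQ.re_det_submatrix_nonneg ![0, 2]
  have h03 := hQ.re_det_submatrix_nonneg ![0, 3]
  have h12 := hQ.re_det_submatrix_nonneg ![1, 2]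
  have h13 := hQ.re_det_submatrix_nonneg ![1, 3]
  rw [det_fin_two] at h02 h03 h12 h13
  simp [Qmat] at h02 h03 h12 h13
  simp only [norm3_sq, dot3, Matrix.cons_val]
  linarith

/-- The sum of the `3 × 3` principal minors of `Q` is nonnegative. -/
lemma Qmat_cubic_nonneg
    (hQ : (Qmat E₀ c₁ c₂ c₃ c₄ c₁' c₂' c₃' c₄' J₁₂ J₁₃ J₂₃ J₁₄ J₂₄ J₃₄).PosSemidef) :
    0 ≤ E₀ * (E₀ ^ 2 - c₄ ^ 2 - c₄' ^ 2 - norm3 ![c₁, c₂, c₃] ^ 2 - norm3 ![c₁', c₂', c₃'] ^ 2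
        - norm3 ![J₂₃, -J₁₃, J₁₂] ^ 2 - norm3 ![J₁₄, J₂₄, J₃₄] ^ 2)
      + 2 * (c₄' * dot3 ![c₁, c₂, c₃] ![J₁₄, J₂₄, J₃₄]
        - c₄ * dot3 ![c₁', c₂', c₃'] ![J₁₄, J₂₄, J₃₄]
        - dot3 ![c₁', c₂', c₃'] (cross3 ![c₁, c₂, c₃] ![J₂₃, -J₁₃, J₁₂])) := by
  have h012 := hQ.re_det_submatrix_nonneg ![0, 1, 2]
  have h013 := hQ.re_det_submatrix_nonneg ![0, 1, 3]
  have h023 := hQ.re_det_submatrix_nonneg ![0, 2, 3]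
  have h123 := hQ.re_det_submatrix_nonneg ![1, 2, 3]
  rw [det_fin_three] at h012 h013 h023 h123
  simp [Qmat] at h012 h013 h023 h123
  simp only [norm3_sq, dot3, cross3, Matrix.cons_val]
  linarith

end Qmat

theorem stmt12 (E₀ c₁ c₂ c₃ c₄ c₁' c₂' c₃' c₄' J₁₂ J₁₃ J₂₃ J₁₄ J₂₄ J₃₄ : ℝ)
    (hQ : (Qmat E₀ c₁ c₂ c₃ c₄ c₁' c₂' c₃' c₄' J₁₂ J₁₃ J₂₃ J₁₄ J₂₄ J₃₄).PosSemidef) :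
    E₀ * ((E₀ + norm3 ![c₁', c₂', c₃'] + norm3 ![J₁₄, J₂₄, J₃₄]) ^ 2
      - (c₄ ^ 2 + c₄' ^ 2 + norm3 ![c₁, c₂, c₃] ^ 2 + norm3 ![c₁', c₂', c₃'] ^ 2 + norm3 ![J₂₃, -J₁₃, J₁₂] ^ 2 + norm3 ![J₁₄, J₂₄, J₃₄] ^ 2) - norm3 ![c₁', c₂', c₃'] ^ 2 - norm3 ![J₁₄, J₂₄, J₃₄] ^ 2) ≥ 0 := by
  have hE := Qmat_energy_nonneg hQ
  have hminor := Qmat_quadratic_le hQ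
  have hcubic := Qmat_cubic_nonneg hQ
  have hab := abs_dot3_le ![c₁', c₂', c₃'] ![J₁₄, J₂₄, J₃₄]
  have hxb := abs_dot3_le ![c₁, c₂, c₃] ![J₁₄, J₂₄, J₃₄]
  have htriple := (abs_dot3_le ![c₁', c₂', c₃']
    (cross3 ![c₁, c₂, c₃] ![J₂₃, -J₁₃, J₁₂])).trans
    (mul_le_mul_of_nonneg_left (norm3_cross3_le _ _) (norm3_nonneg _))
  have ha0 := norm3_nonneg ![c₁', c₂', c₃']
  have hb0 := norm3_nonneg ![J₁₄, J₂₄, J₃₄]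
  generalize norm3 ![c₁, c₂, c₃] = x at *
  generalize norm3 ![J₂₃, -J₁₃, J₁₂] = j at *
  generalize norm3 ![c₁', c₂', c₃'] = a at *
  generalize norm3 ![J₁₄, J₂₄, J₃₄] = b at *
  generalize dot3 ![c₁', c₂', c₃'] ![J₁₄, J₂₄, J₃₄] = s at *
  generalize dot3 ![c₁, c₂, c₃] ![J₁₄, J₂₄, J₃₄] = t at *
  generalize dot3 ![c₁', c₂', c₃'] (cross3 ![c₁, c₂, c₃] ![J₂₃, -J₁₃, J₁₂]) = r at *
  have hc₄ : |c₄| ≤ E₀ := by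
    apply abs_le_of_sq_le_sq _ hE
    nlinarith [sq_nonneg c₄', sq_nonneg x, sq_nonneg j]
  have hc₄' : |c₄'| * x ≤ E₀ ^ 2 := by
    nlinarith [sq_nonneg c₄, sq_nonneg j, sq_nonneg (|c₄'| - x), sq_abs c₄']
  have hxj : x * j ≤ E₀ ^ 2 := by
    nlinarith [sq_nonneg c₄, sq_nonneg c₄', sq_nonneg (x - j)]
  have hs : |c₄ * s| ≤ E₀ * (a * b) := by
    rw [abs_mul]
    exact mul_le_mul hc₄ hab (abs_nonneg _) hE
  have ht : |c₄' * t| ≤ E₀ ^ 2 * b := by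
    rw [abs_mul]
    linarith [mul_le_mul_of_nonneg_left hxb (abs_nonneg c₄'),
      mul_le_mul_of_nonneg_right hc₄' hb0]
  have hr : |r| ≤ a * E₀ ^ 2 := htriple.trans (mul_le_mul_of_nonneg_left hxj ha0)
  linarith [neg_le_of_abs_le hr, le_of_abs_le hr, neg_le_of_abs_le hs, le_of_abs_le ht]
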